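/- arXiv:2206.11872 — 5 statements merged into one kernel-verified Lean document; each statement's English description precedes it below -/
import Mathlib

section
/- Let f : ℝ^d → ℝ be twice differentiable and L-smooth, and let w ∈ ℝ^d. Suppose there exists a global minimizer w_* of f such that the average Hessian H_f(w) = ∫₀¹ ∇²f(θw + (1−θ)w_*) dθ satisfies λ_min(H_f(w)) ≥ λ_* for some λ_* > 0. Then f satisfies the PL inequality at w with parameter μ = λ_*²/L; that is, ‖∇f(w)‖² ≥ 2(λ_*²/L)(f(w) − f(w_*)). -/
/-- Smallest eigenvalue of a symmetric matrix, as the infimum of the Rayleigh quotient. -/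
noncomputable def lambdaMin {d : ℕ} (A : Matrix (Fin d) (Fin d) ℝ) : ℝ :=
  sInf {r : ℝ | ∃ v : EuclideanSpace ℝ (Fin d), ‖v‖ = 1 ∧ r = ∑ i, ∑ j, v i * A i j * v j}

/-- Hessian matrix of `f` at `x`, via the second iterated Fréchet derivative. -/
noncomputable def hessMat {d : ℕ} (f : EuclideanSpace ℝ (Fin d) → ℝ)
    (x : EuclideanSpace ℝ (Fin d)) : Matrix (Fin d) (Fin d) ℝ :=
  fun i j => iteratedFDeriv ℝ 2 f x ![EuclideanSpace.single i 1, EuclideanSpace.single j 1]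

/-- Average Hessian of `f` between `w` and `wstar`:  `∫₀¹ ∇²f(θw + (1-θ)w⋆) dθ`. -/
noncomputable def avgHess {d : ℕ} (f : EuclideanSpace ℝ (Fin d) → ℝ)
    (wstar w : EuclideanSpace ℝ (Fin d)) : Matrix (Fin d) (Fin d) ℝ :=
  fun i j => ∫ θ in (0 : ℝ)..1, hessMat f (θ • w + (1 - θ) • wstar) i j

theorem sum_sum_hessMat_eq_fderiv {d : ℕ} (f : EuclideanSpace ℝ (Fin d) → ℝ)
    (x v : EuclideanSpace ℝ (Fin d)) :
    ∑ i, ∑ j, v i * hessMat f x i j * v j = fderiv ℝ (fderiv ℝ f) x v v := by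
  have hv : v = ∑ i, v i • EuclideanSpace.single i (1 : ℝ) := by
    simpa using ((EuclideanSpace.basisFun (Fin d) ℝ).sum_repr v).symm
  conv_rhs => rw [hv]
  simp only [map_sum, map_smul, sum_apply, smul_apply,
    smul_eq_mul, hessMat, iteratedFDeriv_two_apply, Matrix.cons_val_zero, Matrix.cons_val_one]
  rw [Finset.sum_comm]
  refine Finset.sum_congr rfl fun i _ => ?_
  rw [Finset.mul_sum]
  refine Finset.sum_congr rfl fun j _ => ?_
  ring

theorem lambdaMin_le {d : ℕ} (A : Matrix (Fin d) (Fin d) ℝ) (v : EuclideanSpace ℝ (Fin d))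
    (hv : ‖v‖ = 1) : lambdaMin A ≤ ∑ i, ∑ j, v i * A i j * v j := by
  refine csInf_le ⟨-∑ i, ∑ j, |A i j|, ?_⟩ ⟨v, hv, rfl⟩
  rintro r ⟨u, hu, rfl⟩
  have hcoord : ∀ i, |u i| ≤ 1 := fun i => by
    simpa [hu] using PiLp.norm_apply_le u i
  refine neg_le_of_abs_le ?_
  refine (Finset.abs_sum_le_sum_abs _ _).trans (Finset.sum_le_sum fun i _ => ?_)
  refine (Finset.abs_sum_le_sum_abs _ _).trans (Finset.sum_le_sum fun j _ => ?_)
  rw [abs_mul, abs_mul]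
  calc |u i| * |A i j| * |u j| ≤ 1 * |A i j| * 1 := by
        gcongr
        · exact hcoord i
        · exact hcoord j
    _ = |A i j| := by ring

theorem lambdaMin_mul_sq_norm_le {d : ℕ} (A : Matrix (Fin d) (Fin d) ℝ)
    (v : EuclideanSpace ℝ (Fin d)) :
    lambdaMin A * ‖v‖ ^ 2 ≤ ∑ i, ∑ j, v i * A i j * v j := by
  rcases eq_or_ne v 0 with rfl | hv
  · simp
  have hv' : 0 < ‖v‖ := norm_pos_iff.mpr hv
  have h := lambdaMin_le A (‖v‖⁻¹ • v) (norm_smul_inv_norm (𝕜 := ℝ) hv)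
  have hsum : ∑ i, ∑ j, (‖v‖⁻¹ • v) i * A i j * (‖v‖⁻¹ • v) j
      = (‖v‖ ^ 2)⁻¹ * ∑ i, ∑ j, v i * A i j * v j := by
    simp only [Finset.mul_sum, PiLp.smul_apply, smul_eq_mul]
    refine Finset.sum_congr rfl fun i _ => Finset.sum_congr rfl fun j _ => ?_
    ring
  rwa [hsum, inv_mul_eq_div, le_div_iff₀ (by positivity)] at h

theorem hasDerivAt_smul_add_one_sub_smul {E : Type*} [NormedAddCommGroup E] [NormedSpace ℝ E]
    (x y : E) (t : ℝ) : HasDerivAt (fun s : ℝ => s • y + (1 - s) • x) (y - x) t := by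
  have h := ((hasDerivAt_id t).smul_const y).add
    (((hasDerivAt_id t).const_sub 1).smul_const x)
  exact h.congr_deriv (by module)

/-- The average Hessian maps the displacement to the increment of the gradient; here paired
with the displacement. -/
theorem sum_sum_avgHess_eq_sub {d : ℕ} {f : EuclideanSpace ℝ (Fin d) → ℝ} (hf : ContDiff ℝ 2 f)
    (x y : EuclideanSpace ℝ (Fin d)) :
    ∑ i, ∑ j, (y - x) i * avgHess f x y i j * (y - x) j
      = fderiv ℝ f y (y - x) - fderiv ℝ f x (y - x) := by
  have hf' : ContDiff ℝ 1 (fderiv ℝ f) := hf.fderiv_right (by norm_num)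
  have hf'' : Continuous (fderiv ℝ (fderiv ℝ f)) := hf'.continuous_fderiv (by norm_num)
  have hcont : ∀ i j, Continuous fun θ : ℝ => hessMat f (θ • y + (1 - θ) • x) i j := by
    intro i j
    simp only [hessMat, iteratedFDeriv_two_apply]
    fun_prop
  have hswap : ∑ i, ∑ j, (y - x) i * avgHess f x y i j * (y - x) j
      = ∫ θ in (0 : ℝ)..1, ∑ i, ∑ j,
          (y - x) i * hessMat f (θ • y + (1 - θ) • x) i j * (y - x) j := by
    rw [intervalIntegral.integral_finsetSum fun i _ => Continuous.intervalIntegrable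
      (continuous_finsetSum _ fun j _ => ((hcont i j).const_mul _).mul_const _) _ _]
    refine Finset.sum_congr rfl fun i _ => ?_
    rw [intervalIntegral.integral_finsetSum fun j _ => Continuous.intervalIntegrable
      (((hcont i j).const_mul _).mul_const _) _ _]
    refine Finset.sum_congr rfl fun j _ => ?_
    rw [intervalIntegral.integral_mul_const, intervalIntegral.integral_const_mul, avgHess]
  rw [hswap]
  simp only [sum_sum_hessMat_eq_fderiv]
  have hderiv : ∀ θ ∈ Set.uIcc (0 : ℝ) 1,
      HasDerivAt (fun s : ℝ => fderiv ℝ f (s • y + (1 - s) • x) (y - x))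
        (fderiv ℝ (fderiv ℝ f) (θ • y + (1 - θ) • x) (y - x) (y - x)) θ := fun θ _ => by
    have h := ((hf'.differentiable (by norm_num)).differentiableAt.hasFDerivAt.comp_hasDerivAt θ
      (hasDerivAt_smul_add_one_sub_smul x y θ)).clm_apply (hasDerivAt_const θ (y - x))
    simpa using h
  rw [intervalIntegral.integral_eq_sub_of_hasDerivAt hderiv
    (Continuous.intervalIntegrable (by fun_prop) _ _)]
  simp

/-- The quadratic upper bound for a function with Lipschitz gradient, at a critical point. -/
theorem sub_le_of_gradient_lipschitz_of_gradient_eq_zero {E : Type*} [NormedAddCommGroup E]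
    [InnerProductSpace ℝ E] [CompleteSpace E] {f : E → ℝ} {L : ℝ} (hf : Differentiable ℝ f)
    (hL : ∀ x y, ‖gradient f x - gradient f y‖ ≤ L * ‖x - y‖) {x : E}
    (hx : gradient f x = 0) (y : E) : f y - f x ≤ L / 2 * ‖y - x‖ ^ 2 := by
  set g : ℝ → ℝ := fun s => f (s • y + (1 - s) • x) - L / 2 * ‖y - x‖ ^ 2 * s ^ 2 with hg
  have hderiv : ∀ t, HasDerivAt g (inner ℝ (gradient f (t • y + (1 - t) • x)) (y - x)
      - L * ‖y - x‖ ^ 2 * t) t := fun t => by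
    have h := ((hf (t • y + (1 - t) • x)).hasGradientAt.hasFDerivAt.comp_hasDerivAt t
      (hasDerivAt_smul_add_one_sub_smul x y t)).sub
      ((hasDerivAt_pow 2 t).const_mul (L / 2 * ‖y - x‖ ^ 2))
    refine h.congr_deriv ?_
    rw [InnerProductSpace.toDual_apply_apply]
    push_cast
    ring
  have hanti : AntitoneOn g (Set.Icc 0 1) := by
    refine antitoneOn_of_deriv_nonpos (convex_Icc 0 1)
      (fun t _ => (hderiv t).continuousAt.continuousWithinAt)
      (fun t _ => (hderiv t).differentiableAt.differentiableWithinAt) fun t ht => ?_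
    rw [interior_Icc] at ht
    rw [(hderiv t).deriv, sub_nonpos]
    have hgrad : ‖gradient f (t • y + (1 - t) • x)‖ ≤ L * (t * ‖y - x‖) := by
      have h := hL (t • y + (1 - t) • x) x
      have hsub : t • y + (1 - t) • x - x = t • (y - x) := by module
      rwa [hx, sub_zero, hsub, norm_smul, Real.norm_of_nonneg ht.1.le] at h
    calc inner ℝ (gradient f (t • y + (1 - t) • x)) (y - x)
        ≤ ‖gradient f (t • y + (1 - t) • x)‖ * ‖y - x‖ := real_inner_le_norm _ _
      _ ≤ L * (t * ‖y - x‖) * ‖y - x‖ := by gcongr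
      _ = L * ‖y - x‖ ^ 2 * t := by ring
  have h := hanti (Set.left_mem_Icc.mpr zero_le_one) (Set.right_mem_Icc.mpr zero_le_one)
    zero_le_one
  simp only [hg, one_smul, zero_smul, sub_self, sub_zero, add_zero, zero_add] at h
  linarith

/-- If the non-convexity of an `L`-smooth, twice differentiable `f` between
`w` and a global minimizer `w⋆` is averaged-out with parameter `λ⋆ > 0`, then `f` satisfies
the `μ`-PL inequality at `w` with `μ = λ⋆²/L` (Theorem 5 of the paper). -/
theorem averagedOut_implies_PL {d : ℕ} (f : EuclideanSpace ℝ (Fin d) → ℝ)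
    (L lamstar : ℝ)
    (wstar w : EuclideanSpace ℝ (Fin d))
    (hf : ContDiff ℝ 2 f)
    (hL : 0 < L)
    (hsmooth : ∀ x y, ‖gradient f x - gradient f y‖ ≤ L * ‖x - y‖)
    (hmin : ∀ v, f wstar ≤ f v)
    (hlam : 0 < lamstar)
    (hAO : lamstar ≤ lambdaMin (avgHess f wstar w)) :
    2 * (lamstar ^ 2 / L) * (f w - f wstar) ≤ ‖gradient f w‖ ^ 2 := by
  have hdiff : Differentiable ℝ f := hf.differentiable (by norm_num)
  have hcrit : fderiv ℝ f wstar = 0 :=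
    IsLocalMin.fderiv_eq_zero (Filter.Eventually.of_forall hmin)
  have hgrad : gradient f wstar = 0 := by simp [gradient, hcrit]
  have hupper := sub_le_of_gradient_lipschitz_of_gradient_eq_zero hdiff hsmooth hgrad w
  have hlower : lamstar * ‖w - wstar‖ ^ 2 ≤ ‖gradient f w‖ * ‖w - wstar‖ := by
    calc lamstar * ‖w - wstar‖ ^ 2
        ≤ lambdaMin (avgHess f wstar w) * ‖w - wstar‖ ^ 2 := by gcongr
      _ ≤ fderiv ℝ f w (w - wstar) := by
        have h := lambdaMin_mul_sq_norm_le (avgHess f wstar w) (w - wstar)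
        rwa [sum_sum_avgHess_eq_sub hf, hcrit, zero_apply, sub_zero] at h
      _ = inner ℝ (gradient f w) (w - wstar) := by simp [gradient]
      _ ≤ ‖gradient f w‖ * ‖w - wstar‖ := real_inner_le_norm _ _
  have hnorm : lamstar * ‖w - wstar‖ ≤ ‖gradient f w‖ := by
    rcases (norm_nonneg (w - wstar)).eq_or_lt with h0 | hpos
    · simp [← h0]
    · exact le_of_mul_le_mul_right (by linarith) hpos
  calc 2 * (lamstar ^ 2 / L) * (f w - f wstar)
      ≤ 2 * (lamstar ^ 2 / L) * (L / 2 * ‖w - wstar‖ ^ 2) := by gcongr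
    _ = (lamstar * ‖w - wstar‖) ^ 2 := by field_simp
    _ ≤ ‖gradient f w‖ ^ 2 := by gcongr
end

section
/- Fix β ∈ (0,1] and λ, λ' ∈ (0,1] with (1 − √λ)² < β and (1 − √λ')² < β. Define the complex numbers z = (1 + β − λ)/2 + i√(β − ((1 + β − λ)/2)²) and z' = (1 + β − λ')/2 + i√(β − ((1 + β − λ')/2)²), and the invertible 2×2 complex matrices Q = [[z, z̄], [1, 1]] and Q' = [[z', z̄'], [1, 1]]. Then the spectral norm of G = Q⁻¹Q' satisfies: ‖G‖₂ = √(1 + (λ − λ')/((1 + √β)² − λ)) if λ ≥ λ', and ‖G‖₂ = √(1 + (λ' − λ)/(λ − (1 − √β)²)) if λ' ≥ λ. -/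
/-- Spectral norm (ℓ₂ operator norm) of a matrix. -/
noncomputable def specNorm {𝕜 : Type*} [RCLike 𝕜] {m n : Type*} [Fintype m] [Fintype n]
    [DecidableEq n] (A : Matrix m n 𝕜) : ℝ :=
  ‖LinearMap.toContinuousLinearMap (Matrix.toEuclideanLin A)‖

open Matrix in
theorem specNorm_conj_pair (p q : ℂ) :
    specNorm !![p, q; starRingEnd ℂ q, starRingEnd ℂ p] = ‖p‖ + ‖q‖ := by
  unfold specNorm
  apply le_antisymm
  · refine ContinuousLinearMap.opNorm_le_bound _ (by positivity) fun x => ?_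
    simp only [LinearMap.coe_toContinuousLinearMap', EuclideanSpace.norm_eq, Fin.sum_univ_two,
      ofLp_toLpLin, toLin'_apply, cons_mulVec, cons_dotProduct, empty_mulVec,
      dotProduct_of_isEmpty, cons_val_zero, cons_val_one, vecHead, vecTail, Function.comp,
      Fin.succ_zero_eq_one, add_zero, toEuclideanLin]
    apply Real.sqrt_le_iff.2 ⟨by positivity, ?_⟩
    rw [mul_pow, Real.sq_sqrt (by positivity)]
    have h0 := norm_add_le (p * x 0) (q * x 1)
    have h1 := norm_add_le (starRingEnd ℂ q * x 0) (starRingEnd ℂ p * x 1)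
    simp only [norm_mul, RCLike.norm_conj] at h0 h1
    calc
      _ ≤ (‖p‖ * ‖x 0‖ + ‖q‖ * ‖x 1‖) ^ 2 + (‖q‖ * ‖x 0‖ + ‖p‖ * ‖x 1‖) ^ 2 := by gcongr
      _ ≤ _ := by
        have : 0 ≤ 2 * (‖p‖ * ‖q‖) * (‖x 0‖ - ‖x 1‖) ^ 2 := by positivity
        linarith
  · have key (w : ℂ) : ∃ u : ℂ, ‖u‖ = 1 ∧ w * u = ‖w‖ ∧ starRingEnd ℂ w = ‖w‖ * u := by
      rcases eq_or_ne w 0 with rfl | hw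
      · exact ⟨1, by simp⟩
      · have hn : (‖w‖ : ℂ) ≠ 0 := by simpa using hw
        refine ⟨starRingEnd ℂ w / ‖w‖, by simp [hw], ?_, by field_simp⟩
        rw [← mul_div_assoc, Complex.mul_conj', sq, mul_div_assoc, div_self hn, mul_one]
    obtain ⟨u, hu, hpu, hpc⟩ := key p
    obtain ⟨v, hv, hqv, hqc⟩ := key q
    have h := (LinearMap.toContinuousLinearMap (toEuclideanLin
      !![p, q; starRingEnd ℂ q, starRingEnd ℂ p])).le_opNorm !₂[u, v]
    have e : ‖(‖q‖ * v * u + ‖p‖ * u * v : ℂ)‖ = ‖p‖ + ‖q‖ := by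
      rw [show (‖q‖ * v * u + ‖p‖ * u * v : ℂ) = ((‖p‖ + ‖q‖ : ℝ) : ℂ) * (u * v) by
        push_cast; ring, norm_mul, norm_mul, hu, hv, Complex.norm_of_nonneg (by positivity)]
      ring
    have e' : ‖(‖p‖ + ‖q‖ : ℂ)‖ = ‖p‖ + ‖q‖ := by
      rw [← Complex.ofReal_add, Complex.norm_of_nonneg (by positivity)]
    have hL : ‖LinearMap.toContinuousLinearMap (toEuclideanLin
        !![p, q; starRingEnd ℂ q, starRingEnd ℂ p]) !₂[u, v]‖ = (‖p‖ + ‖q‖) * √2 := by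
      simp only [LinearMap.coe_toContinuousLinearMap', EuclideanSpace.norm_eq, Fin.sum_univ_two,
        ofLp_toLpLin, toLin'_apply, cons_mulVec, cons_dotProduct, empty_mulVec,
        dotProduct_of_isEmpty, cons_val_zero, cons_val_one, vecHead, vecTail, Function.comp,
        Fin.succ_zero_eq_one, add_zero, toEuclideanLin]
      rw [hpu, hqv, hqc, hpc, e, e', ← mul_two, Real.sqrt_mul (by positivity),
        Real.sqrt_sq (by positivity)]
    have hR : ‖(!₂[u, v] : EuclideanSpace ℂ (Fin 2))‖ = √2 := by
      simp [EuclideanSpace.norm_eq, hu, hv, one_add_one_eq_two]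
    rw [hL, hR] at h
    exact le_of_mul_le_mul_right h (by positivity)

/-- The norms of the two chords from `z'` to `z` and to its conjugate, for points on a common
circle centred at the origin. -/
theorem sq_norm_sub_conj_add_norm_sub {z z' : ℂ} {s : ℝ} (hz : ‖z‖ = s) (hz' : ‖z'‖ = s) :
    (‖z' - starRingEnd ℂ z‖ + ‖z' - z‖) ^ 2 =
      4 * (s ^ 2 - z.re * z'.re + s * |z'.re - z.re|) := by
  have hprod : ‖z' - starRingEnd ℂ z‖ * ‖z' - z‖ = 2 * s * |z'.re - z.re| := by
    have h1 : (z' - starRingEnd ℂ z) * (z' - z) = z' * ((2 * (z'.re - z.re) : ℝ) : ℂ) := by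
      have h2 := Complex.mul_conj' z
      have h3 := Complex.mul_conj' z'
      have h4 := Complex.add_conj z
      have h5 := Complex.add_conj z'
      rw [hz] at h2
      rw [hz'] at h3
      push_cast at h4 h5 ⊢
      linear_combination h2 - h3 - z' * h4 + z' * h5
    rw [← norm_mul, h1, norm_mul, hz', Complex.norm_real, Real.norm_eq_abs, abs_mul, abs_two]
    ring
  have h2 : z.re ^ 2 + z.im ^ 2 = s ^ 2 := by
    rw [← hz, Complex.sq_norm, Complex.normSq_apply]; ring
  have h3 : z'.re ^ 2 + z'.im ^ 2 = s ^ 2 := by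
    rw [← hz', Complex.sq_norm, Complex.normSq_apply]; ring
  have h4 : ‖z' - starRingEnd ℂ z‖ ^ 2 + ‖z' - z‖ ^ 2 = 4 * (s ^ 2 - z.re * z'.re) := by
    simp only [Complex.sq_norm, Complex.normSq_apply, Complex.sub_re, Complex.sub_im,
      Complex.conj_re, Complex.conj_im]
    linear_combination 2 * h2 + 2 * h3
  linear_combination h4 + 2 * hprod

theorem specNorm_inv_mul_conj_pair {z z' : ℂ} (hz : 0 < z.im) :
    specNorm ((!![z, starRingEnd ℂ z; 1, 1])⁻¹ * !![z', starRingEnd ℂ z'; 1, 1]) =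
      (‖z' - starRingEnd ℂ z‖ + ‖z' - z‖) / (2 * z.im) := by
  have hd : z - starRingEnd ℂ z = ((2 * z.im : ℝ) : ℂ) * Complex.I := Complex.sub_conj z
  have hne : z - starRingEnd ℂ z ≠ 0 := by
    rw [hd]; simp [hz.ne']
  have hne' : starRingEnd ℂ z - z ≠ 0 := by
    rw [← neg_sub]; exact neg_ne_zero.2 hne
  have hnorm : ‖z - starRingEnd ℂ z‖ = 2 * z.im := by
    rw [hd, norm_mul, Complex.norm_I, mul_one, Complex.norm_of_nonneg (by positivity)]
  have hG : (!![z, starRingEnd ℂ z; 1, 1])⁻¹ * !![z', starRingEnd ℂ z'; 1, 1] =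
      !![(z' - starRingEnd ℂ z) / (z - starRingEnd ℂ z),
          starRingEnd ℂ (z' - z) / (z - starRingEnd ℂ z);
        starRingEnd ℂ (starRingEnd ℂ (z' - z) / (z - starRingEnd ℂ z)),
        starRingEnd ℂ ((z' - starRingEnd ℂ z) / (z - starRingEnd ℂ z))] := by
    have hdet : IsUnit (!![z, starRingEnd ℂ z; 1, 1]).det := by
      simpa [Matrix.det_fin_two_of] using hne
    let _ := Matrix.invertibleOfIsUnitDet _ hdet
    refine (Matrix.inv_mul_eq_iff_eq_mul_of_invertible _ _ _).2 ?_
    ext i j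
    fin_cases i <;> fin_cases j <;>
      simp [Matrix.mul_apply, Fin.sum_univ_two] <;>
      rw [← neg_sub z (starRingEnd ℂ z)] <;> field_simp <;> ring
  rw [hG, specNorm_conj_pair, norm_div, norm_div, RCLike.norm_conj, hnorm]
  ring

theorem abs_one_add_sub_div_two_lt_sqrt {β lam : ℝ} (hβ : β ∈ Set.Ioc (0 : ℝ) 1)
    (hlam : lam ∈ Set.Ioc (0 : ℝ) 1) (hb : (1 - √lam) ^ 2 < β) :
    |(1 + β - lam) / 2| < √β := by
  obtain ⟨h0, h1⟩ := hlam
  have hs : 0 < √β := Real.sqrt_pos.2 hβ.1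
  have hs1 : √β ≤ 1 := Real.sqrt_le_one.2 hβ.2
  have hsq : √β ^ 2 = β := Real.sq_sqrt hβ.1.le
  have hr : √lam ^ 2 = lam := Real.sq_sqrt h0.le
  have hr1 : √lam ≤ 1 := Real.sqrt_le_one.2 h1
  have hr0 : 0 < √lam := Real.sqrt_pos.2 h0
  have h : |1 - √lam| < √β := by
    rw [← Real.sqrt_sq_eq_abs]; exact Real.sqrt_lt_sqrt (sq_nonneg _) hb
  rw [abs_of_nonneg (by linarith)] at h
  rw [abs_lt]
  constructor <;> nlinarith

/-- Closed-form expression for the extra factor `‖Q⁻¹Q'‖₂` in the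
instantaneous rate of Heavy Ball with constant momentum `β` (Lemma 2 of the paper,
constant-`β` case). -/
theorem heavyBall_extra_factor_formula (β lam lam' : ℝ)
    (hβ : β ∈ Set.Ioc (0 : ℝ) 1)
    (hlam : lam ∈ Set.Ioc (0 : ℝ) 1) (hlam' : lam' ∈ Set.Ioc (0 : ℝ) 1)
    (hb : (1 - Real.sqrt lam) ^ 2 < β) (hb' : (1 - Real.sqrt lam') ^ 2 < β)
    (z z' : ℂ)
    (hz : z = ((1 + β - lam) / 2 : ℝ) +
      (Real.sqrt (β - ((1 + β - lam) / 2) ^ 2) : ℝ) * Complex.I)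
    (hz' : z' = ((1 + β - lam') / 2 : ℝ) +
      (Real.sqrt (β - ((1 + β - lam') / 2) ^ 2) : ℝ) * Complex.I)
    (Q Q' G : Matrix (Fin 2) (Fin 2) ℂ)
    (hQ : Q = !![z, starRingEnd ℂ z; 1, 1])
    (hQ' : Q' = !![z', starRingEnd ℂ z'; 1, 1])
    (hG : G = Q⁻¹ * Q') :
    (lam' ≤ lam →
        specNorm G = Real.sqrt (1 + (lam - lam') / ((1 + Real.sqrt β) ^ 2 - lam)))
      ∧ (lam ≤ lam' →
        specNorm G = Real.sqrt (1 + (lam' - lam) / (lam - (1 - Real.sqrt β) ^ 2))) := by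
  have hβ0 : 0 < β := hβ.1
  have hs : 0 < √β := Real.sqrt_pos.2 hβ0
  have hsq : √β ^ 2 = β := Real.sq_sqrt hβ0.le
  have ha := abs_one_add_sub_div_two_lt_sqrt hβ hlam hb
  have ha' := abs_one_add_sub_div_two_lt_sqrt hβ hlam' hb'
  have hc : 0 < β - ((1 + β - lam) / 2) ^ 2 := by
    rw [← sq_abs]; nlinarith [abs_nonneg ((1 + β - lam) / 2)]
  have hc' : 0 < β - ((1 + β - lam') / 2) ^ 2 := by
    rw [← sq_abs]; nlinarith [abs_nonneg ((1 + β - lam') / 2)]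
  have hre : z.re = (1 + β - lam) / 2 := by rw [hz, ← Complex.mk_eq_add_mul_I]
  have hre' : z'.re = (1 + β - lam') / 2 := by rw [hz', ← Complex.mk_eq_add_mul_I]
  have him : z.im = √(β - ((1 + β - lam) / 2) ^ 2) := by rw [hz, ← Complex.mk_eq_add_mul_I]
  have hn : ‖z‖ = √β := by
    rw [hz, Complex.norm_add_mul_I, Real.sq_sqrt hc.le, add_sub_cancel]
  have hn' : ‖z'‖ = √β := by
    rw [hz', Complex.norm_add_mul_I, Real.sq_sqrt hc'.le, add_sub_cancel]
  have hpos : 0 < z.im := him ▸ Real.sqrt_pos.2 hc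
  have hG2 : specNorm G = √((β - (1 + β - lam) / 2 * ((1 + β - lam') / 2) +
      √β * |(lam - lam') / 2|) / (β - ((1 + β - lam) / 2) ^ 2)) := by
    rw [hG, hQ, hQ', specNorm_inv_mul_conj_pair hpos]
    have h := sq_norm_sub_conj_add_norm_sub hn hn'
    rw [hsq, hre, hre',
      show (1 + β - lam') / 2 - (1 + β - lam) / 2 = (lam - lam') / 2 by ring] at h
    have him2 : z.im ^ 2 = β - ((1 + β - lam) / 2) ^ 2 := by rw [him, Real.sq_sqrt hc.le]
    rw [← Real.sqrt_sq (by positivity : 0 ≤ (‖z' - starRingEnd ℂ z‖ + ‖z' - z‖) / (2 * z.im)),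
      div_pow, h, mul_pow, him2]
    congr 1
    rw [show (2 : ℝ) ^ 2 = 4 by norm_num, mul_div_mul_left _ _ (by norm_num)]
  obtain ⟨ha1, ha2⟩ := abs_lt.1 ha
  have hd1 : 0 < (1 + √β) ^ 2 - lam := by nlinarith
  have hd2 : 0 < lam - (1 - √β) ^ 2 := by nlinarith
  constructor
  · intro hle
    rw [hG2, abs_of_nonneg (by linarith)]
    congr 1
    rw [one_add_div hd1.ne', div_eq_div_iff hc.ne' hd1.ne']
    generalize √β = s at hsq ⊢
    rw [← hsq]
    ring
  · intro hle
    rw [hG2, abs_of_nonpos (by linarith)]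
    congr 1
    rw [one_add_div hd2.ne', div_eq_div_iff hc.ne' hd2.ne']
    generalize √β = s at hsq ⊢
    rw [← hsq]
    ring
end

section
/- For every real x ≠ 0, sin(2x)/x ≥ −0.46. -/
theorem Real.neg_mul_le_sin_of_nonneg {y : ℝ} (hy : 0 ≤ y) : -(0.23 * y) ≤ Real.sin y := by
  have hpi := Real.pi_gt_d2
  rcases le_total y Real.pi with h | h
  · linarith [Real.sin_nonneg_of_nonneg_of_le_pi hy h]
  rcases le_total (2 * Real.pi) y with h2 | h2
  · linarith [Real.neg_one_le_sin y]
  obtain ⟨t, rfl⟩ : ∃ t, y = Real.pi * (3 / 2 - t) :=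
    ⟨3 / 2 - y / Real.pi, by field_simp; ring⟩
  have ht : -(1 / 2) ≤ t := by nlinarith
  have ht' : t ≤ 1 / 2 := by nlinarith
  have hcos := Real.cos_le_one_sub_mul_cos_sq (x := Real.pi * t)
    (abs_le.2 ⟨by nlinarith, by nlinarith⟩)
  have hsq : 2 / Real.pi ^ 2 * (Real.pi * t) ^ 2 = 2 * t ^ 2 := by field_simp
  have hsin : Real.sin (Real.pi * (3 / 2 - t)) = -Real.cos (Real.pi * t) := by
    rw [show Real.pi * (3 / 2 - t) = Real.pi / 2 - Real.pi * t + Real.pi by ring,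
      Real.sin_add_pi, Real.sin_pi_div_two_sub]
  rw [hsin]
  nlinarith [sq_nonneg (t - 0.18)]

/-- For every real `x ≠ 0`, `sin(2x)/x ≥ -0.46` (Lemma 13 of the paper). -/
theorem sin_two_mul_div_ge (x : ℝ) (hx : x ≠ 0) :
    -0.46 ≤ Real.sin (2 * x) / x := by
  rcases hx.lt_or_gt with h | h
  · have := Real.neg_mul_le_sin_of_nonneg (y := 2 * -x) (by linarith)
    rw [mul_neg, Real.sin_neg] at this
    rw [le_div_iff_of_neg h]
    linarith
  · have := Real.neg_mul_le_sin_of_nonneg (y := 2 * x) (by linarith)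
    rw [le_div_iff₀ h]
    linarith
end

section
/- Let α ∈ (1, 4.34] and define f : ℝ → ℝ by f(w) = w² + α sin²(w). Then f is non-convex (there exists w with f''(w) < 0), f is L-smooth with L = 2 + 2α, its second derivative is 4α-Lipschitz, its global minimum is f(0) = 0, and for every w ≠ 0 the PL inequality (f'(w))² ≥ 2μ(w) f(w) holds with μ(w) = (2 + α sin(2w)/w)²/(2 + 2α); moreover μ(w) ≥ (2 − 0.46α)²/(2 + 2α) > 0, so f satisfies the μ-PL condition globally with μ = (2 − 0.46α)²/(2 + 2α). -/
open Real in
/-- The minimum of `sin x / x` is about `-0.217`; the constant `-0.23` leaves enough room for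
the quadratic upper bound on the cosine. -/
theorem neg_mul_le_sin_of_nonneg {x : ℝ} (hx : 0 ≤ x) : -(0.23 * x) ≤ sin x := by
  have hπ := pi_gt_d4
  have hπ' := pi_lt_d4
  rcases le_total x π with h | h
  · linarith [sin_nonneg_of_nonneg_of_le_pi hx h]
  rcases le_total 5 x with h5 | h5
  · linarith [neg_one_le_sin x]
  set u := 3 * π / 2 - x with hu
  have hxu : x = 3 * π / 2 - u := by rw [hu]; ring
  have hsin : sin x = -cos u := by
    rw [hxu, show 3 * π / 2 - u = π / 2 - u + π by ring, sin_add_pi, sin_pi_div_two_sub]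
  have hcos : cos u ≤ 1 - 2 / π ^ 2 * u ^ 2 :=
    cos_le_one_sub_mul_cos_sq (abs_le.2 ⟨by linarith, by linarith⟩)
  have hcoef : 0.2 ≤ 2 / π ^ 2 := by
    rw [le_div_iff₀ (by positivity)]
    nlinarith
  have hmul := mul_le_mul_of_nonneg_right hcoef (sq_nonneg u)
  rw [hsin]
  nlinarith [sq_nonneg (u - 0.575)]

open Real in
theorem neg_le_sin_two_mul_div {w : ℝ} (hw : w ≠ 0) : -0.46 ≤ sin (2 * w) / w := by
  rcases hw.lt_or_gt with h | h
  · have := neg_mul_le_sin_of_nonneg (x := 2 * -w) (by linarith)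
    rw [mul_neg, sin_neg] at this
    rw [le_div_iff_of_neg h]
    linarith
  · have := neg_mul_le_sin_of_nonneg (x := 2 * w) (by linarith)
    rw [le_div_iff₀ h]
    linarith

open Real in
theorem hasDerivAt_sq_add_mul_sin_sq (α w : ℝ) :
    HasDerivAt (fun w => w ^ 2 + α * sin w ^ 2) (2 * w + α * sin (2 * w)) w := by
  refine (((hasDerivAt_id w).pow 2).add (((hasDerivAt_sin w).pow 2).const_mul α)).congr_deriv ?_
  rw [sin_two_mul]
  simp [mul_assoc]

open Real in
theorem hasDerivAt_two_mul_add_mul_sin (α w : ℝ) :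
    HasDerivAt (fun w => 2 * w + α * sin (2 * w)) (2 + 2 * α * cos (2 * w)) w := by
  have h : HasDerivAt (fun w : ℝ => 2 * w) 2 w := by
    simpa using (hasDerivAt_id w).const_mul 2
  exact (h.add (h.sin.const_mul α)).congr_deriv (by ring)


/-- Properties of `f(w) = w² + α sin²(w)` for `α ∈ (1, 4.34]`
(Lemma 5 of the paper): `f` is non-convex, `(2+2α)`-smooth, has `4α`-Lipschitz second
derivative, attains its global minimum `f(0) = 0`, satisfies the pointwise PL inequality
with `μ(w) = (2 + α sin(2w)/w)²/(2+2α)` at every `w ≠ 0`, and satisfies the global `μ`-PL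
condition with `μ = (2 - 0.46α)²/(2+2α) > 0`. -/
theorem sinSq_nonconvex_PL (α : ℝ) (hα : α ∈ Set.Ioc (1 : ℝ) 4.34) (f : ℝ → ℝ)
    (hf : f = fun w => w ^ 2 + α * Real.sin w ^ 2) :
    (∃ w : ℝ, deriv (deriv f) w < 0)
      ∧ (∀ x y : ℝ, |deriv f x - deriv f y| ≤ (2 + 2 * α) * |x - y|)
      ∧ (∀ x y : ℝ, |deriv (deriv f) x - deriv (deriv f) y| ≤ 4 * α * |x - y|)
      ∧ f 0 = 0
      ∧ (∀ w : ℝ, 0 ≤ f w)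
      ∧ (∀ w : ℝ, w ≠ 0 →
          2 * ((2 + α * Real.sin (2 * w) / w) ^ 2 / (2 + 2 * α)) * f w ≤ deriv f w ^ 2)
      ∧ (∀ w : ℝ, w ≠ 0 →
          (2 - 0.46 * α) ^ 2 / (2 + 2 * α) ≤
            (2 + α * Real.sin (2 * w) / w) ^ 2 / (2 + 2 * α))
      ∧ 0 < (2 - 0.46 * α) ^ 2 / (2 + 2 * α)
      ∧ (∀ w : ℝ, 2 * ((2 - 0.46 * α) ^ 2 / (2 + 2 * α)) * f w ≤ deriv f w ^ 2) := by
  obtain ⟨h1, h2⟩ := hα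
  have hα0 : 0 < α := by linarith
  have hd : deriv f = fun w => 2 * w + α * Real.sin (2 * w) := by
    rw [hf]
    exact funext fun w => (hasDerivAt_sq_add_mul_sin_sq α w).deriv
  have hdd : deriv (deriv f) = fun w => 2 + 2 * α * Real.cos (2 * w) := by
    rw [hd]
    exact funext fun w => (hasDerivAt_two_mul_add_mul_sin α w).deriv
  have hf0 : f 0 = 0 := by simp [hf]
  have hnum : 0 < 2 - 0.46 * α := by norm_num at h2 ⊢; linarith
  have hscale (x y : ℝ) : |2 * x - 2 * y| = 2 * |x - y| := by
    rw [← mul_sub, abs_mul, abs_two]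
  have hnonneg (w : ℝ) : 0 ≤ f w := by rw [hf]; positivity
  have hPL (w : ℝ) (hw : w ≠ 0) :
      2 * ((2 + α * Real.sin (2 * w) / w) ^ 2 / (2 + 2 * α)) * f w ≤ deriv f w ^ 2 := by
    have hfw : f w ≤ (1 + α) * w ^ 2 := by
      have := mul_le_mul_of_nonneg_left (sq_le_sq.2 (Real.abs_sin_le_abs (x := w))) hα0.le
      rw [hf]
      linarith
    calc _ ≤ 2 * ((2 + α * Real.sin (2 * w) / w) ^ 2 / (2 + 2 * α)) * ((1 + α) * w ^ 2) := by
          gcongr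
      _ = deriv f w ^ 2 := by
          rw [hd]
          field_simp
  have hμ (w : ℝ) (hw : w ≠ 0) : (2 - 0.46 * α) ^ 2 / (2 + 2 * α) ≤
      (2 + α * Real.sin (2 * w) / w) ^ 2 / (2 + 2 * α) := by
    have := mul_le_mul_of_nonneg_left (neg_le_sin_two_mul_div hw) hα0.le
    rw [← mul_div_assoc] at this
    gcongr
    linarith
  refine ⟨⟨Real.pi / 2, ?_⟩, fun x y => ?_, fun x y => ?_, hf0, hnonneg, hPL, hμ, by positivity,
    fun w => ?_⟩
  · rw [hdd]
    simp only [mul_div_cancel₀ Real.pi (two_ne_zero' ℝ), Real.cos_pi]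
    linarith
  · have hs := Real.abs_sin_sub_sin_le (2 * x) (2 * y)
    rw [hscale] at hs
    rw [hd]
    calc |2 * x + α * Real.sin (2 * x) - (2 * y + α * Real.sin (2 * y))|
        = |(2 * x - 2 * y) + α * (Real.sin (2 * x) - Real.sin (2 * y))| := by ring_nf
      _ ≤ 2 * |x - y| + α * |Real.sin (2 * x) - Real.sin (2 * y)| := by
          refine (abs_add_le _ _).trans_eq ?_
          rw [hscale, abs_mul, abs_of_pos hα0]
      _ ≤ 2 * |x - y| + α * (2 * |x - y|) := by gcongr
      _ = (2 + 2 * α) * |x - y| := by ring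
  · have hc := Real.abs_cos_sub_cos_le (2 * x) (2 * y)
    rw [hscale] at hc
    rw [hdd]
    calc |2 + 2 * α * Real.cos (2 * x) - (2 + 2 * α * Real.cos (2 * y))|
        = |2 * α * (Real.cos (2 * x) - Real.cos (2 * y))| := by ring_nf
      _ = 2 * α * |Real.cos (2 * x) - Real.cos (2 * y)| := by
          rw [abs_mul, abs_of_pos (by positivity : 0 < 2 * α)]
      _ ≤ 2 * α * (2 * |x - y|) := by gcongr
      _ = 4 * α * |x - y| := by ring
  · rcases eq_or_ne w 0 with rfl | hw
    · rw [hf0, mul_zero]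
      positivity
    · refine le_trans ?_ (hPL w hw)
      gcongr ?_ * _
      · exact hnonneg w
      · exact mul_le_mul_of_nonneg_left (hμ w hw) two_pos.le
end

section
/- Let N ≥ 1 be an integer, w_* ∈ ℝ^d, and define f : ℝ^d → ℝ by f(u) = (1/N²) Σ_{i=1}^d (u_i^N − w_{*,i})². Then for every u ∈ ℝ^d, ‖∇f(u)‖² ≥ 4 (min_{i∈[d]} u_i^{2(N−1)}) · f(u); equivalently, f satisfies the μ-PL inequality at u with μ = 2 min_{i∈[d]} u_i^{2(N−1)} (noting min_u f(u) = 0). -/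
open WithLp in
/-- The gradient of the diagonal-network objective is `(2/N) (uᴺ - w⋆) ⊙ u^{N-1}`. -/
theorem hasGradientAt_diagonalNetwork {d N : ℕ} (hN : N ≠ 0) (wstar : Fin d → ℝ)
    (u : EuclideanSpace ℝ (Fin d)) :
    HasGradientAt
      (fun v : EuclideanSpace ℝ (Fin d) ↦ (1 / (N : ℝ) ^ 2) * ∑ i, (v i ^ N - wstar i) ^ 2)
      (toLp 2 fun i ↦ 2 / (N : ℝ) * (u i ^ N - wstar i) * u i ^ (N - 1)) u := by
  have hcoord (i : Fin d) : HasFDerivAt (fun v : EuclideanSpace ℝ (Fin d) ↦ v i)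
      (EuclideanSpace.proj i : EuclideanSpace ℝ (Fin d) →L[ℝ] ℝ) u :=
    (EuclideanSpace.proj i : EuclideanSpace ℝ (Fin d) →L[ℝ] ℝ).hasFDerivAt
  have hsum := (HasFDerivAt.fun_sum (u := Finset.univ) fun i _ ↦
    (((hcoord i).pow N).sub_const (wstar i)).pow 2).const_mul (1 / (N : ℝ) ^ 2)
  rw [hasGradientAt_iff_hasFDerivAt]
  refine hsum.congr_fderiv ?_
  ext v
  have hN' : (N : ℝ) ≠ 0 := Nat.cast_ne_zero.mpr hN
  simp only [smul_apply, sum_apply,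
    InnerProductSpace.toDual_apply_apply, PiLp.inner_apply, PiLp.proj_apply, smul_eq_mul,
    nsmul_eq_mul, Finset.mul_sum, RCLike.inner_apply, conj_trivial]
  refine Finset.sum_congr rfl fun i _ ↦ ?_
  field_simp
  push_cast
  ring


/-- For the diagonal-network objective
`f(u) = (1/N²) Σᵢ (uᵢᴺ - w⋆ᵢ)²`, the PL-type inequality
`‖∇f(u)‖² ≥ 4 (minᵢ uᵢ^{2(N-1)}) f(u)` holds at every `u` (Lemma "deep" of the paper). -/
theorem diagonalNetwork_PL {d N : ℕ} (hN : 1 ≤ N) (wstar : Fin d → ℝ)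
    (f : EuclideanSpace ℝ (Fin d) → ℝ)
    (hf : ∀ u : EuclideanSpace ℝ (Fin d),
      f u = (1 / (N : ℝ) ^ 2) * ∑ i, (u i ^ N - wstar i) ^ 2) :
    ∀ u : EuclideanSpace ℝ (Fin d),
      4 * (⨅ i : Fin d, u i ^ (2 * (N - 1))) * f u ≤ ‖gradient f u‖ ^ 2 := by
  intro u
  have hgrad := hasGradientAt_diagonalNetwork (Nat.one_le_iff_ne_zero.mp hN) wstar u
  rw [← funext hf] at hgrad
  rw [hgrad.gradient, EuclideanSpace.norm_sq_eq, hf, Finset.mul_sum, Finset.mul_sum]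
  refine Finset.sum_le_sum fun i _ ↦ ?_
  have hmin : ⨅ j : Fin d, u j ^ (2 * (N - 1)) ≤ u i ^ (2 * (N - 1)) :=
    ciInf_le (Set.finite_range _).bddBelow i
  calc 4 * (⨅ j : Fin d, u j ^ (2 * (N - 1))) * (1 / (N : ℝ) ^ 2 * (u i ^ N - wstar i) ^ 2)
      ≤ 4 * u i ^ (2 * (N - 1)) * (1 / (N : ℝ) ^ 2 * (u i ^ N - wstar i) ^ 2) := by gcongr
    _ = ‖2 / (N : ℝ) * (u i ^ N - wstar i) * u i ^ (N - 1)‖ ^ 2 := by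
      rw [Real.norm_eq_abs, sq_abs, mul_comm 2 (N - 1), pow_mul]
      ring
end
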